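/- Let F and p be positive integers and let a be the smallest positive integer that does not divide F. Then Sat(F) contains at least one element of Sat(F)-rank equal to p if and only if a·(2^p − 1) < F. -/

import Mathlib

/-- A numerical semigroup: subset of ℕ containing 0, closed under addition,
with finite complement. -/
def IsNumericalSemigroup (S : Set ℕ) : Prop :=
  0 ∈ S ∧ (∀ a ∈ S, ∀ b ∈ S, a + b ∈ S) ∧ Sᶜ.Finite

/-- `dOf S s = gcd {x ∈ S : x ≤ s}`. -/
noncomputable def dOf (S : Set ℕ) (s : ℕ) : ℕ :=
  letI := Classical.decPred (· ∈ S)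
  ((Finset.range (s + 1)).filter (· ∈ S)).gcd id

/-- A saturated numerical semigroup. -/
def IsSaturatedNS (S : Set ℕ) : Prop :=
  IsNumericalSemigroup S ∧ ∀ s ∈ S, s ≠ 0 → s + dOf S s ∈ S

/-- `Sat F`: saturated numerical semigroups with Frobenius number `F`. -/
def SatF (F : ℕ) : Set (Set ℕ) :=
  {S | IsSaturatedNS S ∧ F ∉ S ∧ ∀ x, x ∉ S → x ≤ F}

/-- Multiplicity: least nonzero element. -/
noncomputable def multOf (S : Set ℕ) : ℕ := sInf {x | x ∈ S ∧ x ≠ 0}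

/-- Pseudo-Frobenius numbers. -/
def PFset (S : Set ℕ) : Set ℕ := {z | z ∉ S ∧ ∀ s ∈ S, s ≠ 0 → z + s ∈ S}

/-- Special gaps. -/
def SGset (S : Set ℕ) : Set ℕ := {x | x ∈ PFset S ∧ 2 * x ∈ S}

/-- `TSet a b = ⟨a⟩ ∪ {x : x ≥ b}`. -/
def TSet (a b : ℕ) : Set ℕ := {x | a ∣ x} ∪ {x | b ≤ x}

/-- A `Sat(F)`-set. -/
def SatFSet (F : ℕ) (X : Set ℕ) : Prop :=
  X ∩ ({0} ∪ {x | F + 1 ≤ x}) = ∅ ∧ ∃ S ∈ SatF F, X ⊆ S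

/-- `Sat(F)[X]`: intersection of all elements of `Sat F` containing `X`. -/
def SatClosure (F : ℕ) (X : Set ℕ) : Set ℕ := ⋂₀ {S | S ∈ SatF F ∧ X ⊆ S}

/-- `X` is a minimal `Sat(F)`-system of generators of `S`. -/
def IsMinSatGen (F : ℕ) (X S : Set ℕ) : Prop :=
  SatFSet F X ∧ SatClosure F X = S ∧ ∀ Y : Set ℕ, Y ⊂ X → SatClosure F Y ≠ S

/-- The `Sat(F)`-rank of `S`: minimal cardinality of a `Sat(F)`-set `X`
with `Sat(F)[X] = S`. -/
noncomputable def SatRank (F : ℕ) (S : Set ℕ) : ℕ :=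
  sInf {k | ∃ X : Set ℕ, SatFSet F X ∧ SatClosure F X = S ∧ X.ncard = k}

lemma dvd_dOf {S : Set ℕ} {s e : ℕ} : e ∣ dOf S s ↔ ∀ x ∈ S, x ≤ s → e ∣ x := by
  simp only [dOf, Finset.dvd_gcd_iff, Finset.mem_filter, Finset.mem_range, id, Nat.lt_succ_iff]
  exact ⟨fun h x hx hxs => h x ⟨hxs, hx⟩, fun h x hx => h x hx.2 hx.1⟩

lemma dOf_dvd {S : Set ℕ} {s x : ℕ} (hx : x ∈ S) (hxs : x ≤ s) : dOf S s ∣ x :=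
  dvd_dOf.1 dvd_rfl x hx hxs

lemma dOf_dvd_dOf {S T : Set ℕ} {s t : ℕ} (hST : S ⊆ T) (h : s ≤ t) : dOf T t ∣ dOf S s :=
  dvd_dOf.2 fun _ hx hxs => dOf_dvd (hST hx) (hxs.trans h)

lemma dOf_zero (S : Set ℕ) : dOf S 0 = 0 :=
  Nat.eq_zero_of_zero_dvd <| dvd_dOf.2 fun _ _ hx => by simpa using hx

lemma dOf_eq_pred_of_not_mem {S : Set ℕ} {s : ℕ} (hs : s ∉ S) : dOf S s = dOf S (s - 1) := by
  refine Nat.dvd_antisymm (dOf_dvd_dOf subset_rfl (Nat.sub_le _ _)) (dvd_dOf.2 fun x hx hxs => ?_)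
  refine dOf_dvd hx ?_
  have : x ≠ s := by rintro rfl; exact hs hx
  omega

lemma dOf_eq_pred_of_dvd {S : Set ℕ} {s : ℕ} (hs : dOf S (s - 1) ∣ s) :
    dOf S s = dOf S (s - 1) := by
  refine Nat.dvd_antisymm (dOf_dvd_dOf subset_rfl (Nat.sub_le _ _)) (dvd_dOf.2 fun x hx hxs => ?_)
  by_cases h : x = s
  · exact h ▸ hs
  · exact dOf_dvd hx (by omega)

lemma IsSaturatedNS.mem_of_mem_of_dvd {S : Set ℕ} (hS : IsSaturatedNS S) {x : ℕ} :
    ∀ {s : ℕ}, s ∈ S → s ≠ 0 → dOf S s ∣ x → s ≤ x → x ∈ S := by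
  suffices ∀ n s, x - s = n → s ∈ S → s ≠ 0 → dOf S s ∣ x → s ≤ x → x ∈ S from
    fun {s} => this _ s rfl
  intro n
  induction n using Nat.strong_induction_on with
  | _ n ih =>
    intro s hn hs h0 hd hle
    rcases hle.eq_or_lt with rfl | hlt
    · exact hs
    have hds : dOf S s ∣ s := dOf_dvd hs le_rfl
    have hpos : 0 < dOf S s := Nat.pos_of_dvd_of_pos hds (Nat.pos_of_ne_zero h0)
    have hle' : dOf S s ≤ x - s := Nat.le_of_dvd (by omega) (Nat.dvd_sub hd hds)
    exact ih (x - (s + dOf S s)) (by omega) _ rfl (hS.2 s hs h0) (by omega)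
      ((dOf_dvd_dOf subset_rfl (by omega)).trans hd) (by omega)

lemma IsSaturatedNS.mem_of_dOf_dvd {S : Set ℕ} (hS : IsSaturatedNS S) {x m : ℕ}
    (h0 : dOf S m ≠ 0) (hd : dOf S m ∣ x) (hmx : m ≤ x) : x ∈ S := by
  induction m with
  | zero => exact absurd (dOf_zero S) h0
  | succ m ih =>
    by_cases hm : m + 1 ∈ S
    · exact hS.mem_of_mem_of_dvd hm (by omega) hd hmx
    · have h := dOf_eq_pred_of_not_mem hm
      rw [Nat.add_sub_cancel] at h
      rw [h] at h0 hd
      exact ih h0 hd (by omega)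

/-- The positive integers up to `m` at which the gcd `dOf S` changes value. -/
noncomputable def gcdDrops (S : Set ℕ) (m : ℕ) : Finset ℕ :=
  (Finset.Icc 1 m).filter fun s => dOf S s ≠ dOf S (s - 1)

lemma mem_gcdDrops {S : Set ℕ} {m s : ℕ} :
    s ∈ gcdDrops S m ↔ (1 ≤ s ∧ s ≤ m) ∧ dOf S s ≠ dOf S (s - 1) := by
  simp [gcdDrops]

lemma gcdDrops_subset (S : Set ℕ) (m : ℕ) : (gcdDrops S m : Set ℕ) ⊆ S := by
  intro s hs
  by_contra h
  exact (mem_gcdDrops.1 hs).2 (dOf_eq_pred_of_not_mem h)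

lemma dOf_dvd_dOf_of_gcdDrops_subset {S T : Set ℕ} {m s : ℕ} (h : (gcdDrops S m : Set ℕ) ⊆ T)
    (hs : s ≤ m) : dOf T s ∣ dOf S s := by
  induction s with
  | zero => simp [dOf_zero]
  | succ s ih =>
    have ih' := (dOf_dvd_dOf (subset_refl T) (Nat.le_succ s)).trans (ih (by omega))
    by_cases hd : dOf S (s + 1) = dOf S s
    · rwa [hd]
    · have hT : s + 1 ∈ T := h (mem_gcdDrops.2 ⟨⟨by omega, hs⟩, hd⟩)
      refine dvd_dOf.2 fun x hx hxs => ?_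
      rcases hxs.eq_or_lt with rfl | hlt
      · exact dOf_dvd hT le_rfl
      · exact ih'.trans (dOf_dvd hx (by omega))

lemma satClosure_gcdDrops {F : ℕ} {S : Set ℕ} (hS : S ∈ SatF F) :
    SatClosure F (gcdDrops S F) = S := by
  refine Set.Subset.antisymm (Set.sInter_subset_of_mem ⟨hS, gcdDrops_subset S F⟩) ?_
  rintro s hs T ⟨hT, hDT⟩
  by_contra hsT
  have hsF := hT.2.2 s hsT
  have hs0 : s ≠ 0 := by rintro rfl; exact hsT hT.1.1.1
  have hd : dOf T s ∣ s :=
    (dOf_dvd_dOf_of_gcdDrops_subset hDT hsF).trans (dOf_dvd hs le_rfl)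
  exact hsT (hT.1.mem_of_dOf_dvd (fun h => hs0 (Nat.eq_zero_of_zero_dvd (h ▸ hd))) hd le_rfl)

lemma diff_singleton_mem_satF {F : ℕ} {S : Set ℕ} (hS : S ∈ SatF F) {n : ℕ}
    (hn : n ∈ gcdDrops S F) : S \ {n} ∈ SatF F := by
  obtain ⟨⟨h1, hnF⟩, hne⟩ := mem_gcdDrops.1 hn
  obtain ⟨⟨⟨h0, hadd, -⟩, hsat⟩, hF, hle⟩ := hS
  have hen : ¬ dOf S (n - 1) ∣ n := fun h => hne (dOf_eq_pred_of_dvd h)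
  have hle' : ∀ x, x ∉ S \ {n} → x ≤ F := by
    intro x hx
    by_cases hxn : x = n
    · omega
    · exact hle x fun h => hx ⟨h, hxn⟩
  refine ⟨⟨⟨⟨h0, ?_⟩, ?_, (Set.finite_Iic F).subset hle'⟩, ?_⟩, fun h => hF h.1, hle'⟩
  · simp only [Set.mem_singleton_iff]; omega
  · rintro x ⟨hx, hxn⟩ y ⟨hy, hyn⟩
    refine ⟨hadd x hx y hy, ?_⟩
    simp only [Set.mem_singleton_iff] at hxn hyn ⊢
    intro h
    refine hen ?_
    conv_rhs => rw [← h]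
    exact dvd_add (dOf_dvd hx (by omega)) (dOf_dvd hy (by omega))
  · rintro s ⟨hs, hsn⟩ hs0
    have hdd : dOf S s ∣ dOf (S \ {n}) s := dOf_dvd_dOf Set.sdiff_subset le_rfl
    have hpos : 0 < dOf (S \ {n}) s :=
      Nat.pos_of_dvd_of_pos (dOf_dvd ⟨hs, hsn⟩ le_rfl) (Nat.pos_of_ne_zero hs0)
    refine ⟨IsSaturatedNS.mem_of_mem_of_dvd ⟨⟨h0, hadd, ?_⟩, hsat⟩ hs hs0
      (dvd_add (dOf_dvd hs le_rfl) hdd) (by omega), ?_⟩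
    · exact (Set.finite_Iic F).subset hle
    · simp only [Set.mem_singleton_iff] at hsn ⊢
      intro h
      refine hen ?_
      conv_rhs => rw [← h]
      exact dvd_add (dOf_dvd hs (by omega)) (dOf_dvd_dOf Set.sdiff_subset (by omega))

lemma gcdDrops_subset_of_satClosure_eq {F : ℕ} {S X : Set ℕ} (hS : S ∈ SatF F)
    (hX : SatClosure F X = S) : (gcdDrops S F : Set ℕ) ⊆ X := by
  intro n hn
  by_contra hnX
  have hXS : X ⊆ S := hX ▸ Set.subset_sInter fun T hT => hT.2
  have hnS : n ∈ SatClosure F X := hX ▸ gcdDrops_subset S F hn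
  exact (hnS _ ⟨diff_singleton_mem_satF hS hn,
    fun x hx => ⟨hXS hx, fun h => hnX (h ▸ hx)⟩⟩).2 rfl

theorem satRank_eq_card_gcdDrops {F : ℕ} {S : Set ℕ} (hS : S ∈ SatF F) :
    SatRank F S = (gcdDrops S F).card := by
  have hmem : (gcdDrops S F).card ∈
      {k | ∃ X : Set ℕ, SatFSet F X ∧ SatClosure F X = S ∧ X.ncard = k} := by
    refine ⟨gcdDrops S F, ⟨?_, S, hS, gcdDrops_subset S F⟩, satClosure_gcdDrops hS,
      Set.ncard_coe_finset _⟩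
    ext x
    simp only [Set.mem_inter_iff, Finset.mem_coe, mem_gcdDrops, Set.mem_union,
      Set.mem_singleton_iff, Set.mem_ofPred_eq, Set.mem_empty_iff_false, iff_false]
    omega
  refine le_antisymm (Nat.sInf_le hmem) (le_csInf ⟨_, hmem⟩ ?_)
  rintro _ ⟨X, hXF, hX, rfl⟩
  rw [← Set.ncard_coe_finset]
  refine Set.ncard_le_ncard (gcdDrops_subset_of_satClosure_eq hS hX)
    ((Set.finite_Iic F).subset fun x hx => ?_)
  by_contra hxF
  have : x ∈ X ∩ ({0} ∪ {x | F + 1 ≤ x}) :=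
    ⟨hx, Or.inr (by simpa [Nat.succ_le_iff] using hxF)⟩
  rw [hXF.1] at this
  exact this

lemma gcdDrops_succ (S : Set ℕ) (m : ℕ) : gcdDrops S (m + 1) =
    if dOf S (m + 1) = dOf S m then gcdDrops S m else insert (m + 1) (gcdDrops S m) := by
  split_ifs with h <;> ext x <;> simp only [Finset.mem_insert, mem_gcdDrops] <;>
    rcases eq_or_ne x (m + 1) with rfl | hx <;> simp [*] <;> omega

lemma dOf_mul_two_pow_le (S : Set ℕ) (m : ℕ) :
    dOf S m * (2 ^ (gcdDrops S m).card - 1) ≤ m := by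
  induction m with
  | zero => simp [dOf_zero]
  | succ m ih =>
    rw [gcdDrops_succ]
    split_ifs with h
    · rw [h]; omega
    · rw [Finset.card_insert_of_notMem (by simp [mem_gcdDrops]), pow_succ]
      have hdrop : m + 1 ∈ gcdDrops S (m + 1) := mem_gcdDrops.2 ⟨⟨by omega, le_rfl⟩, h⟩
      have hdvd : dOf S (m + 1) ∣ m + 1 := dOf_dvd (gcdDrops_subset _ _ hdrop) le_rfl
      have hdd : dOf S (m + 1) ∣ dOf S m := dOf_dvd_dOf subset_rfl (Nat.le_succ m)
      have hk : 1 ≤ 2 ^ (gcdDrops S m).card := Nat.one_le_two_pow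
      obtain ⟨c, hc⟩ : ∃ c, 2 ^ (gcdDrops S m).card = c + 1 := ⟨_, (Nat.sub_add_cancel hk).symm⟩
      rw [hc, Nat.add_sub_cancel] at ih
      rw [hc, show (c + 1) * 2 - 1 = 2 * c + 1 by omega]
      have hstep : dOf S (m + 1) ≤ m + 1 - dOf S m * c :=
        Nat.le_of_dvd (by omega) (Nat.dvd_sub hdvd (hdd.mul_right c))
      have hhalf : dOf S (m + 1) * 2 * c ≤ dOf S m * c := by
        obtain ⟨q, hq⟩ := hdd
        rcases q with _ | _ | q
        · rw [mul_zero] at hq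
          rcases Nat.eq_zero_or_pos c with rfl | hcpos
          · simp
          · exfalso
            have hempty : gcdDrops S m = ∅ := by
              refine Finset.eq_empty_of_forall_notMem fun x hx => ?_
              have hx0 := dOf_dvd (gcdDrops_subset _ _ hx) (mem_gcdDrops.1 hx).1.2
              rw [hq] at hx0
              have := Nat.eq_zero_of_zero_dvd hx0
              have := (mem_gcdDrops.1 hx).1.1
              omega
            rw [hempty] at hc
            simp at hc
            omega
        · exact absurd (by simpa using hq.symm) h
        · rw [hq]
          exact Nat.mul_le_mul_right _ (Nat.mul_le_mul_left _ (by omega))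
      calc dOf S (m + 1) * (2 * c + 1) = dOf S (m + 1) * 2 * c + dOf S (m + 1) := by ring
        _ ≤ m + 1 := by omega

/-- The union of `{0}`, the integers above `F`, and, for `j < p`, the multiples of `a * 2 ^ j`
from `a * (2 ^ p - 2 ^ j)` on. -/
def dyadicSat (F p a : ℕ) : Set ℕ :=
  {x | x = 0 ∨ F < x ∨ ∃ j < p, a * 2 ^ j ∣ x ∧ a * 2 ^ p ≤ x + a * 2 ^ j}

lemma dyadicSat_mem_satF {F p a : ℕ} (hF : 0 < F) (haF : ¬ a ∣ F) :
    dyadicSat F p a ∈ SatF F := by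
  have hle : ∀ x, x ∉ dyadicSat F p a → x ≤ F := fun x hx =>
    not_lt.1 fun h => hx (Or.inr (Or.inl h))
  refine ⟨⟨⟨Or.inl rfl, ?_, (Set.finite_Iic F).subset hle⟩, ?_⟩, ?_, hle⟩
  · rintro x (rfl | hx | ⟨i, hi, hix, hi'⟩) y (rfl | hy | ⟨j, hj, hjy, hj'⟩)
    · exact Or.inl rfl
    · exact Or.inr (Or.inl (by omega))
    · exact Or.inr (Or.inr ⟨j, hj, by simpa using hjy, by omega⟩)
    · exact Or.inr (Or.inl (by omega))
    · exact Or.inr (Or.inl (by omega))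
    · exact Or.inr (Or.inl (by omega))
    · exact Or.inr (Or.inr ⟨i, hi, by simpa using hix, by omega⟩)
    · exact Or.inr (Or.inl (by omega))
    · rcases le_total i j with hij | hij
      · exact Or.inr (Or.inr ⟨i, hi, dvd_add hix
          ((Nat.mul_dvd_mul_left a (pow_dvd_pow 2 hij)).trans hjy), by omega⟩)
      · exact Or.inr (Or.inr ⟨j, hj, dvd_add
          ((Nat.mul_dvd_mul_left a (pow_dvd_pow 2 hij)).trans hix) hjy, by omega⟩)
  · intro s hs hs0
    by_cases hsF : F < s
    · exact Or.inr (Or.inl (by omega))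
    have hex : ∃ j, j < p ∧ a * 2 ^ p ≤ s + a * 2 ^ j := by
      rcases hs with h | h | ⟨j, hj, -, h⟩
      · exact absurd h hs0
      · exact absurd h hsF
      · exact ⟨j, hj, h⟩
    classical
    obtain ⟨hj, hjs⟩ := Nat.find_spec hex
    have hdvd : a * 2 ^ Nat.find hex ∣ dOf (dyadicSat F p a) s := by
      refine dvd_dOf.2 ?_
      rintro x (rfl | hx | ⟨i, hi, hix, hi'⟩) hxs
      · exact dvd_zero _
      · omega
      · exact (Nat.mul_dvd_mul_left a (pow_dvd_pow 2
          (Nat.find_min' hex ⟨hi, by omega⟩))).trans hix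
    exact Or.inr (Or.inr ⟨_, hj, dvd_add (hdvd.trans (dOf_dvd hs le_rfl)) hdvd, by omega⟩)
  · rintro (h | h | ⟨j, -, h, -⟩)
    · omega
    · omega
    · exact haF ((Dvd.intro _ rfl).trans h)

lemma dyadicSat_corner_mem {F p a j : ℕ} (hj : j < p) :
    a * (2 ^ p - 2 ^ j) ∈ dyadicSat F p a := by
  have hpow : 2 ^ j ≤ 2 ^ p := Nat.pow_le_pow_right two_pos hj.le
  refine Or.inr (Or.inr ⟨j, hj, Nat.mul_dvd_mul_left a
    (Nat.dvd_sub (pow_dvd_pow 2 hj.le) dvd_rfl), ?_⟩)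
  rw [← mul_add, Nat.sub_add_cancel hpow]

lemma dOf_dyadicSat_dvd {F p a j s : ℕ} (hj : j < p) (hs : a * (2 ^ p - 2 ^ j) ≤ s) :
    dOf (dyadicSat F p a) s ∣ a * 2 ^ j := by
  have h1 := dOf_dvd (dyadicSat_corner_mem (F := F) (a := a) hj) hs
  have hpow : 2 ^ j + 2 ^ j ≤ 2 ^ p := by
    rw [← two_mul, ← pow_succ']
    exact Nat.pow_le_pow_right two_pos hj
  have h2 : dOf (dyadicSat F p a) s ∣ a * (2 ^ p - 2 ^ (j + 1)) := by
    rcases Nat.lt_or_ge (j + 1) p with h | h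
    · exact dOf_dvd (dyadicSat_corner_mem h)
        ((Nat.mul_le_mul_left a (Nat.sub_le_sub_left
          (Nat.pow_le_pow_right two_pos (Nat.le_succ j)) _)).trans hs)
    · simp [show p = j + 1 by omega]
  have h3 := Nat.dvd_sub h1 h2
  rw [← Nat.mul_sub, pow_succ'] at h3
  rwa [show 2 ^ p - 2 ^ j - (2 ^ p - 2 * 2 ^ j) = 2 ^ j by omega] at h3

lemma gcdDrops_dyadicSat {F p a : ℕ} (ha : 0 < a) (h : a * (2 ^ p - 1) < F) :
    gcdDrops (dyadicSat F p a) F =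
      (Finset.range p).image fun j => a * (2 ^ p - 2 ^ j) := by
  ext s
  simp only [Finset.mem_image, Finset.mem_range]
  constructor
  · intro hs
    obtain ⟨⟨h1, hsF⟩, hne⟩ := mem_gcdDrops.1 hs
    rcases gcdDrops_subset _ _ hs with rfl | hlt | ⟨j, hj, hjs, hj'⟩
    · omega
    · omega
    · refine ⟨j, hj, ?_⟩
      by_contra hsn
      refine hne (dOf_eq_pred_of_dvd ((dOf_dyadicSat_dvd hj ?_).trans hjs))
      rw [Nat.mul_sub] at hsn ⊢
      omega
  · rintro ⟨j, hj, rfl⟩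
    have hlt : 2 ^ j < 2 ^ p := Nat.pow_lt_pow_right one_lt_two hj
    have hpos : 0 < a * (2 ^ p - 2 ^ j) := Nat.mul_pos ha (by omega)
    have hone : 1 ≤ 2 ^ j := Nat.one_le_two_pow
    refine mem_gcdDrops.2 ⟨⟨hpos, (Nat.mul_le_mul_left a (by omega)).trans h.le⟩, fun heq => ?_⟩
    have hdvd : a * 2 ^ (j + 1) ∣ dOf (dyadicSat F p a) (a * (2 ^ p - 2 ^ j) - 1) := by
      refine dvd_dOf.2 ?_
      rintro x (rfl | hx | ⟨i, hi, hix, hi'⟩) hxs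
      · exact dvd_zero _
      · have : a * (2 ^ p - 2 ^ j) ≤ a * (2 ^ p - 1) := Nat.mul_le_mul_left a (by omega)
        omega
      · refine (Nat.mul_dvd_mul_left a (pow_dvd_pow 2 ?_)).trans hix
        by_contra hij
        have : a * 2 ^ i ≤ a * 2 ^ j :=
          Nat.mul_le_mul_left a (Nat.pow_le_pow_right two_pos (by omega))
        rw [Nat.mul_sub] at hxs hpos
        omega
    rw [← heq] at hdvd
    have h1 := hdvd.trans (dOf_dvd (dyadicSat_corner_mem hj) le_rfl)
    have h2 := Nat.dvd_of_mul_dvd_mul_left ha h1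
    have h3 := Nat.dvd_sub (pow_dvd_pow 2 (Nat.succ_le_of_lt hj)) h2
    rw [Nat.sub_sub_self hlt.le] at h3
    exact absurd ((Nat.pow_dvd_pow_iff_le_right (by norm_num)).1 h3) (by omega)

/-- `Sat(F)` contains an element of `Sat(F)`-rank `p` iff
`a·(2^p − 1) < F`, where `a` is the least positive integer not dividing `F`. -/
theorem exists_rank_p_iff (F p : ℕ) (hF : 0 < F) (hp : 0 < p)
    (a : ℕ) (ha : 0 < a) (haF : ¬ a ∣ F)
    (hamin : ∀ b, 0 < b → ¬ b ∣ F → a ≤ b) :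
    (∃ S ∈ SatF F, SatRank F S = p) ↔ a * (2 ^ p - 1) < F := by
  constructor
  · rintro ⟨S, hS, hrank⟩
    obtain ⟨m, rfl⟩ : ∃ m, F = m + 1 := ⟨F - 1, by omega⟩
    have hdm := dOf_eq_pred_of_not_mem hS.2.1
    rw [Nat.add_sub_cancel] at hdm
    rw [satRank_eq_card_gcdDrops hS, gcdDrops_succ, if_pos hdm] at hrank
    obtain ⟨x, hx⟩ := Finset.card_pos.1 (hrank ▸ hp)
    have hx1 := (mem_gcdDrops.1 hx).1
    have hpos : 0 < dOf S m :=
      Nat.pos_of_dvd_of_pos (dOf_dvd (gcdDrops_subset _ _ hx) hx1.2) hx1.1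
    have hnd : ¬ dOf S m ∣ m + 1 := fun h =>
      hS.2.1 (hS.1.mem_of_dOf_dvd hpos.ne' h (Nat.le_succ m))
    have hle := dOf_mul_two_pow_le S m
    rw [hrank] at hle
    exact Nat.lt_succ_of_le ((Nat.mul_le_mul_right _ (hamin _ hpos hnd)).trans hle)
  · intro h
    refine ⟨_, dyadicSat_mem_satF (p := p) hF haF, ?_⟩
    rw [satRank_eq_card_gcdDrops (dyadicSat_mem_satF hF haF), gcdDrops_dyadicSat ha h,
      Finset.card_image_of_injOn, Finset.card_range]
    intro i hi j hj hij
    have hi' : 2 ^ i < 2 ^ p := Nat.pow_lt_pow_right one_lt_two (by simpa using hi)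
    have hj' : 2 ^ j < 2 ^ p := Nat.pow_lt_pow_right one_lt_two (by simpa using hj)
    have := Nat.eq_of_mul_eq_mul_left ha hij
    exact Nat.pow_right_injective le_rfl (show 2 ^ i = 2 ^ j by omega)
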